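/- arXiv:2408.00708 — 4 statements merged into one kernel-verified Lean document; each statement's English description precedes it below -/
import Mathlib

section
/- Let X be a real normed linear space and let x, y ∈ X. Then ρ'(x, y) = 0 if and only if for every f ∈ J(x) there exists g ∈ J(x) such that (f + g)(y) = 0. -/
open Filter Set

/-- The norm derivative `ρ'₊(x,y) = lim_{t→0⁺} ‖x‖(‖x+ty‖−‖x‖)/t`.
(This one-sided limit always exists by convexity of the norm, so `limUnder` picks it.) -/
noncomputable def rhoP {X : Type*} [NormedAddCommGroup X] [NormedSpace ℝ X] (x y : X) : ℝ :=
  limUnder (nhdsWithin (0 : ℝ) (Set.Ioi 0))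
    (fun t : ℝ => ‖x‖ * (‖x + t • y‖ - ‖x‖) / t)

/-- The norm derivative `ρ'₋(x,y) = lim_{t→0⁻} ‖x‖(‖x+ty‖−‖x‖)/t`. -/
noncomputable def rhoM {X : Type*} [NormedAddCommGroup X] [NormedSpace ℝ X] (x y : X) : ℝ :=
  limUnder (nhdsWithin (0 : ℝ) (Set.Iio 0))
    (fun t : ℝ => ‖x‖ * (‖x + t • y‖ - ‖x‖) / t)

/-- `ρ'(x,y) = (ρ'₊(x,y) + ρ'₋(x,y))/2`. -/
noncomputable def rho {X : Type*} [NormedAddCommGroup X] [NormedSpace ℝ X] (x y : X) : ℝ :=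
  (rhoP x y + rhoM x y) / 2

/-- The set of support functionals at `x`. -/
def suppJ {X : Type*} [NormedAddCommGroup X] [NormedSpace ℝ X] (x : X) :
    Set (X →L[ℝ] ℝ) :=
  {f | ‖f‖ = 1 ∧ f x = ‖x‖}

open Topology in
lemma np_exists {X : Type*} [NormedAddCommGroup X] [NormedSpace ℝ X] (x : X) :
    ∃ p : X → ℝ, ∀ y, Tendsto (fun t : ℝ => (‖x + t • y‖ - ‖x‖) / t) (𝓝[>] 0) (𝓝 (p y)) := by
  have key : ∀ y : X, ∃ l : ℝ,
      Tendsto (fun t : ℝ => (‖x + t • y‖ - ‖x‖) / t) (𝓝[>] 0) (𝓝 l) := by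
    intro y
    have hc : ConvexOn ℝ univ (fun t : ℝ => ‖x + t • y‖) := by
      refine ⟨convex_univ, ?_⟩
      intro s _ t _ a b ha hb hab
      have h : x + (a • s + b • t) • y = a • (x + s • y) + b • (x + t • y) := by
        have : x = (a + b) • x := by rw [hab, one_smul]
        nth_rewrite 1 [this]
        simp only [smul_eq_mul]
        module
      calc ‖x + (a • s + b • t) • y‖ ≤ ‖a • (x + s • y)‖ + ‖b • (x + t • y)‖ := by
            rw [h]; exact norm_add_le _ _
        _ = a • ‖x + s • y‖ + b • ‖x + t • y‖ := by
            rw [norm_smul, norm_smul, Real.norm_of_nonneg ha, Real.norm_of_nonneg hb]; rfl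
    have h := hc.hasDerivWithinAt_sInf_slope_of_mem_interior (x := 0) (by simp)
    rw [hasDerivWithinAt_iff_tendsto_slope' (by simp)] at h
    refine ⟨_, h.congr fun t => ?_⟩
    simp [slope_def_field]
  choose p hp using key
  exact ⟨p, hp⟩

open Topology in
lemma np_facts {X : Type*} [NormedAddCommGroup X] [NormedSpace ℝ X] (x : X) (p : X → ℝ)
    (hp : ∀ y, Tendsto (fun t : ℝ => (‖x + t • y‖ - ‖x‖) / t) (𝓝[>] 0) (𝓝 (p y))) :
    (∀ c : ℝ, 0 < c → ∀ y, p (c • y) = c * p y) ∧ (∀ y z, p (y + z) ≤ p y + p z) ∧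
    (∀ y, p y ≤ ‖y‖) ∧ p (-x) = -‖x‖ := by
  have hsc : ∀ c : ℝ, 0 < c → Tendsto (fun t : ℝ => c * t) (𝓝[>] 0) (𝓝[>] 0) := by
    intro c hc
    refine tendsto_nhdsWithin_iff.2 ⟨?_, ?_⟩
    · have : Tendsto (fun t : ℝ => c * t) (𝓝 0) (𝓝 (c * 0)) := by
        exact (continuous_const.mul continuous_id).tendsto 0
      rw [mul_zero] at this
      exact this.mono_left nhdsWithin_le_nhds
    · filter_upwards [self_mem_nhdsWithin] with t ht
      exact mul_pos hc ht
  refine ⟨?_, ?_, ?_, ?_⟩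
  · intro c hc y
    refine tendsto_nhds_unique (hp (c • y)) ((((hp y).comp (hsc c hc)).const_mul c).congr' ?_)
    filter_upwards [self_mem_nhdsWithin] with t ht
    have ht : (0 : ℝ) < t := ht
    simp only [Function.comp, smul_smul, mul_comm t c]
    field_simp
  · intro y z
    refine le_of_tendsto_of_tendsto (hp (y + z))
      (((hp y).comp (hsc 2 two_pos)).add ((hp z).comp (hsc 2 two_pos))) ?_
    filter_upwards [self_mem_nhdsWithin] with t ht
    have ht : (0 : ℝ) < t := ht
    simp only [Function.comp]
    rw [← add_div, div_le_div_iff₀ ht (by positivity)]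
    have h : (2 : ℝ) • (x + t • (y + z)) = (x + (2 * t) • y) + (x + (2 * t) • z) := by module
    have h2 := norm_add_le (x + (2 * t) • y) (x + (2 * t) • z)
    rw [← h, norm_smul, Real.norm_of_nonneg (by norm_num : (0 : ℝ) ≤ 2)] at h2
    nlinarith
  · intro y
    refine le_of_tendsto (hp y) ?_
    filter_upwards [self_mem_nhdsWithin] with t ht
    have ht : (0 : ℝ) < t := ht
    rw [div_le_iff₀ ht]
    have h2 := norm_add_le x (t • y)
    rw [norm_smul, Real.norm_of_nonneg ht.le] at h2
    linarith
  · refine tendsto_nhds_unique (hp (-x)) (tendsto_const_nhds.congr' ?_)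
    filter_upwards [Ioo_mem_nhdsGT (show (0 : ℝ) < 1 by norm_num)] with t ht
    have h : x + t • -x = (1 - t) • x := by module
    have h0 := ht.1
    rw [h, norm_smul, Real.norm_of_nonneg (by linarith [ht.2])]
    field_simp
    ring

lemma np_supp {X : Type*} [NormedAddCommGroup X] [NormedSpace ℝ X] (x : X) (hx : x ≠ 0)
    (p : X → ℝ) (h1 : ∀ c : ℝ, 0 < c → ∀ y, p (c • y) = c * p y)
    (h2 : ∀ y z, p (y + z) ≤ p y + p z) (h3 : ∀ y, p y ≤ ‖y‖) (h4 : p (-x) = -‖x‖) (y : X) :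
    ∃ f ∈ suppJ x, f y = p y := by
  have hx' : 0 < ‖x‖ := norm_pos_iff.2 hx
  have p0 : p 0 = 0 := by
    have := h1 2 two_pos 0
    rw [smul_zero] at this
    linarith
  have H : ∀ c : ℝ, c • y = 0 → (RingHom.id ℝ) c • p y = 0 := by
    intro c hc
    rcases smul_eq_zero.1 hc with h | h
    · simp [h]
    · simp [h, p0]
  obtain ⟨g, hg, hgp⟩ := exists_extension_of_le_sublinear
    (LinearPMap.mkSpanSingleton' y (p y) H) p h1 h2 (by
      rintro ⟨z, hz⟩
      obtain ⟨c, rfl⟩ := Submodule.mem_span_singleton.1 hz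
      rw [LinearPMap.mkSpanSingleton'_apply]
      simp only [RingHom.id_apply, smul_eq_mul]
      rcases lt_trichotomy c 0 with hc | hc | hc
      · have e := h1 (-c) (by linarith) y
        have := h2 (c • y) ((-c) • y)
        rw [neg_smul, add_neg_cancel, p0, ← neg_smul, e] at this
        linarith
      · simp [hc, p0]
      · rw [h1 c hc])
  have hb : ∀ z, ‖g z‖ ≤ 1 * ‖z‖ := by
    intro z
    rw [one_mul, Real.norm_eq_abs, abs_le]
    have a := (hgp z).trans (h3 z)
    have b := (hgp (-z)).trans (h3 (-z))
    rw [map_neg, norm_neg] at b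
    exact ⟨by linarith, a⟩
  have hgx : g x = ‖x‖ := by
    have a := (hgp x).trans (h3 x)
    have b := hgp (-x)
    rw [map_neg, h4] at b
    linarith
  refine ⟨g.mkContinuous 1 hb, ⟨le_antisymm (g.mkContinuous_norm_le zero_le_one hb) ?_, hgx⟩, ?_⟩
  · have := (g.mkContinuous 1 hb).le_opNorm x
    rw [LinearMap.mkContinuous_apply, hgx, norm_norm] at this
    exact le_of_mul_le_mul_right (by linarith) hx'
  · have := hg ⟨y, Submodule.mem_span_singleton_self y⟩
    exact this.trans (LinearPMap.mkSpanSingleton'_apply_self y (p y) H _)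

open Topology in
lemma np_le {X : Type*} [NormedAddCommGroup X] [NormedSpace ℝ X] (x : X) (p : X → ℝ)
    (hp : ∀ y, Tendsto (fun t : ℝ => (‖x + t • y‖ - ‖x‖) / t) (𝓝[>] 0) (𝓝 (p y)))
    (f : X →L[ℝ] ℝ) (hf : f ∈ suppJ x) (y : X) : f y ≤ p y := by
  refine ge_of_tendsto (hp y) ?_
  filter_upwards [self_mem_nhdsWithin] with t ht
  have ht : (0 : ℝ) < t := ht
  rw [le_div_iff₀ ht]
  have h := (le_abs_self _).trans (f.le_opNorm (x + t • y))
  rw [hf.1, one_mul, map_add, map_smul, hf.2, smul_eq_mul] at h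
  linarith

lemma suppJ_convex {X : Type*} [NormedAddCommGroup X] [NormedSpace ℝ X] (x : X) (hx : x ≠ 0)
    (f g : X →L[ℝ] ℝ) (hf : f ∈ suppJ x) (hg : g ∈ suppJ x) (a b : ℝ) (ha : 0 ≤ a) (hb : 0 ≤ b)
    (hab : a + b = 1) : a • f + b • g ∈ suppJ x := by
  have hx' : 0 < ‖x‖ := norm_pos_iff.2 hx
  have hv : (a • f + b • g) x = ‖x‖ := by
    simp [hf.2, hg.2, ← add_mul, hab]
  refine ⟨le_antisymm ?_ ?_, hv⟩
  · calc ‖a • f + b • g‖ ≤ ‖a • f‖ + ‖b • g‖ := norm_add_le _ _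
      _ = 1 := by
        rw [norm_smul, norm_smul, hf.1, hg.1, Real.norm_of_nonneg ha, Real.norm_of_nonneg hb]
        linarith
  · have := (a • f + b • g).le_opNorm x
    rw [hv, norm_norm] at this
    exact le_of_mul_le_mul_right (by linarith) hx'

open Topology in
lemma rho_eq {X : Type*} [NormedAddCommGroup X] [NormedSpace ℝ X] (x : X) (p : X → ℝ)
    (hp : ∀ y, Tendsto (fun t : ℝ => (‖x + t • y‖ - ‖x‖) / t) (𝓝[>] 0) (𝓝 (p y))) (y : X) :
    rho x y = ‖x‖ * (p y - p (-y)) / 2 := by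
  have e1 : rhoP x y = ‖x‖ * p y := by
    refine Tendsto.limUnder_eq (((hp y).const_mul ‖x‖).congr fun t => ?_)
    rw [mul_div_assoc]
  have e2 : rhoM x y = ‖x‖ * (-p (-y)) := by
    have hn : Tendsto (fun t : ℝ => -t) (𝓝[<] 0) (𝓝[>] 0) := by
      have := tendsto_neg_nhdsLT (a := (0 : ℝ))
      rwa [neg_zero] at this
    refine Tendsto.limUnder_eq (((((hp (-y)).comp hn).neg).const_mul ‖x‖).congr fun t => ?_)
    simp only [Function.comp, smul_neg, neg_smul, neg_neg, div_neg]
    rw [mul_div_assoc]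
  rw [rho, e1, e2]
  ring

/-- Theorem (ρ-orthogonality via support functionals): ρ'(x,y) = 0 iff for every
support functional f at x there is a support functional g at x with (f+g)(y) = 0. -/
theorem rho_orthogonality_iff {X : Type*} [NormedAddCommGroup X] [NormedSpace ℝ X]
    (x y : X) :
    rho x y = 0 ↔ ∀ f ∈ suppJ x, ∃ g ∈ suppJ x, (f + g) y = 0 := by
  by_cases hx : x = 0
  · subst hx
    constructor
    · intro _ f hf
      exact ⟨-f, ⟨by rw [norm_neg]; exact hf.1, by simp⟩, by simp⟩
    · intro _
      simp [rho, rhoP, rhoM, Tendsto.limUnder_eq tendsto_const_nhds]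
  obtain ⟨p, hp⟩ := np_exists x
  obtain ⟨h1, h2, h3, h4⟩ := np_facts x p hp
  have hx' : 0 < ‖x‖ := norm_pos_iff.2 hx
  rw [rho_eq x p hp y]
  obtain ⟨F, hF, hFy⟩ := np_supp x hx p h1 h2 h3 h4 y
  obtain ⟨G, hG, hGy⟩ := np_supp x hx p h1 h2 h3 h4 (-y)
  rw [map_neg] at hGy
  constructor
  · intro h f hf
    have he : p y = p (-y) := by
      have : ‖x‖ * (p y - p (-y)) = 0 := by linarith
      rcases mul_eq_zero.1 this with h | h <;> linarith
    have u := np_le x p hp f hf y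
    have v := np_le x p hp f hf (-y)
    rw [map_neg] at v
    by_cases hz : p y = 0
    · exact ⟨F, hF, by rw [ContinuousLinearMap.add_apply, hFy]; linarith⟩
    · have hpos : 0 < p y := lt_of_le_of_ne (by linarith) (Ne.symm hz)
      refine ⟨((p y - f y) / (2 * p y)) • F + ((p y + f y) / (2 * p y)) • G,
        suppJ_convex x hx F G hF hG _ _ (div_nonneg (by linarith) (by linarith))
          (div_nonneg (by linarith) (by linarith)) (by field_simp; ring), ?_⟩
      have hG' : G y = -p y := by linarith
      simp only [ContinuousLinearMap.add_apply, ContinuousLinearMap.smul_apply, smul_eq_mul,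
        hFy, hG']
      field_simp
      ring
  · intro h
    obtain ⟨g, hg, e⟩ := h F hF
    obtain ⟨k, hk, e'⟩ := h G hG
    rw [ContinuousLinearMap.add_apply] at e e'
    have a := np_le x p hp g hg (-y)
    have b := np_le x p hp k hk y
    rw [map_neg] at a
    have : p y = p (-y) := by linarith
    rw [this]
    simp
end

section
/- Let X be a real normed linear space and let x, y ∈ X with x ≠ 0. Then ρ'₋(x, y) = 0 if and only if there exists f₀ ∈ J(x) with f₀(y) = 0, and for every f ∈ J(x) and every t ∈ (0, 1), f(t x + (1 − t) y) ≠ 0. -/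
open Filter Set

/-- The left difference quotient of the norm has a limit. -/
lemma exists_left_limit {X : Type*} [NormedAddCommGroup X] [NormedSpace ℝ X] (x y : X) :
    ∃ L : ℝ, Tendsto (fun t : ℝ => (‖x + t • y‖ - ‖x‖) / t)
      (nhdsWithin (0 : ℝ) (Set.Iio 0)) (nhds L) := by
  have hc : ConvexOn ℝ univ (fun t : ℝ => ‖x + t • y‖) := by
    refine ⟨convex_univ, fun a _ b _ p q hp hq hpq => ?_⟩
    have e : x + (p • a + q • b) • y = p • (x + a • y) + q • (x + b • y) := by
      have : x = (p + q) • x := by rw [hpq, one_smul]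
      nth_rewrite 1 [this]
      simp only [smul_eq_mul]
      module
    show ‖x + (p • a + q • b) • y‖ ≤ p • ‖x + a • y‖ + q • ‖x + b • y‖
    rw [e]
    refine (norm_add_le _ _).trans ?_
    rw [norm_smul, norm_smul, Real.norm_of_nonneg hp, Real.norm_of_nonneg hq]
    simp
  have h := hc.hasDerivWithinAt_leftDeriv_of_mem_interior (x := 0) (by simp)
  rw [hasDerivWithinAt_iff_tendsto_slope' (by simp)] at h
  refine ⟨_, h.congr fun t => ?_⟩
  simp [slope_def_field]

/-- Support functionals bound the left derivative from above. -/
lemma left_limit_le {X : Type*} [NormedAddCommGroup X] [NormedSpace ℝ X] {x y : X} {L : ℝ}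
    (hL : Tendsto (fun t : ℝ => (‖x + t • y‖ - ‖x‖) / t)
      (nhdsWithin (0 : ℝ) (Set.Iio 0)) (nhds L)) {f : X →L[ℝ] ℝ} (hf : f ∈ suppJ x) :
    L ≤ f y := by
  refine le_of_tendsto hL ?_
  filter_upwards [self_mem_nhdsWithin] with t ht
  have ht : t < 0 := ht
  rw [div_le_iff_of_neg ht]
  have h1 : f (x + t • y) ≤ ‖x + t • y‖ := by
    have := f.le_opNorm (x + t • y)
    rw [hf.1, one_mul] at this
    exact (le_abs_self _).trans this
  rw [map_add, map_smul, hf.2, smul_eq_mul] at h1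
  linarith

/-- Some support functional attains the left derivative. -/
lemma exists_supp_le {X : Type*} [NormedAddCommGroup X] [NormedSpace ℝ X] {x y : X} {L : ℝ}
    (hx : x ≠ 0)
    (hL : Tendsto (fun t : ℝ => (‖x + t • y‖ - ‖x‖) / t)
      (nhdsWithin (0 : ℝ) (Set.Iio 0)) (nhds L)) : ∃ f ∈ suppJ x, f y ≤ L := by
  choose g hg1 hg2 using fun t : ℝ => exists_dual_vector'' ℝ (x + t • y)
  let U : Ultrafilter ℝ := Ultrafilter.of (nhdsWithin (0 : ℝ) (Set.Iio 0))
  have hU : (U : Filter ℝ) ≤ nhdsWithin (0 : ℝ) (Set.Iio 0) := Ultrafilter.of_le _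
  let G : ℝ → WeakDual ℝ X := fun t => StrongDual.toWeakDual (g t)
  obtain ⟨F, hF, hFl⟩ := (WeakDual.isCompact_closedBall (𝕜 := ℝ) (E := X) 0 1).ultrafilter_le_nhds
    (U.map G) (by
      rw [le_principal_iff]
      refine Filter.mem_of_superset Filter.univ_mem ?_ |> fun h => (h : G ⁻¹' _ ∈ (U : Filter ℝ))
      intro t _
      simpa [G] using hg1 t)
  have hT : Tendsto G U (nhds F) := hFl
  have hev : ∀ z, Tendsto (fun t => g t z) U (nhds (F z)) := fun z =>
    ((WeakDual.eval_continuous z).tendsto F).comp hT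
  have hF1 : ‖WeakDual.toStrongDual F‖ ≤ 1 := by simpa using hF
  have hnorm : ∀ t z, g t z ≤ ‖z‖ := fun t z => by
    have := (g t).le_of_opNorm_le (hg1 t) z
    rw [one_mul] at this
    exact (le_abs_self _).trans this
  have hgt : ∀ t, g t x + t * g t y = ‖x + t • y‖ := fun t => by
    have := hg2 t
    simpa using this
  have h0 : Tendsto (fun t : ℝ => t) U (nhds 0) := hU.trans nhdsWithin_le_nhds
  have hFx : F x = ‖x‖ := by
    have h1 : Tendsto (fun t => g t x + t * g t y) U (nhds (F x + 0 * F y)) :=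
      (hev x).add (h0.mul (hev y))
    have h2 : Tendsto (fun t : ℝ => ‖x + t • y‖) U (nhds ‖x + (0 : ℝ) • y‖) :=
      ((h0.smul_const y).const_add x).norm
    have := tendsto_nhds_unique h1 (h2.congr fun t => (hgt t).symm)
    simpa using this
  refine ⟨WeakDual.toStrongDual F, ⟨le_antisymm hF1 ?_, hFx⟩, ?_⟩
  · have h := (WeakDual.toStrongDual F).le_opNorm x
    rw [WeakDual.toStrongDual_apply, hFx, norm_norm] at h
    exact le_of_mul_le_mul_right (by simpa using h) (norm_pos_iff.2 hx)
  · refine le_of_tendsto_of_tendsto (hev y) (hL.mono_left hU) ?_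
    filter_upwards [hU self_mem_nhdsWithin] with t ht
    have ht : t < 0 := ht
    rw [le_div_iff_of_neg ht]
    have := hgt t
    have := hnorm t x
    linarith

/-- Characterization of ρ₋-orthogonality. -/
theorem rhoM_orthogonality_iff {X : Type*} [NormedAddCommGroup X] [NormedSpace ℝ X]
    (x y : X) (hx : x ≠ 0) :
    rhoM x y = 0 ↔
      ((∃ f₀ ∈ suppJ x, f₀ y = 0) ∧
        ∀ f ∈ suppJ x, ∀ t ∈ Set.Ioo (0 : ℝ) 1, f (t • x + (1 - t) • y) ≠ 0) := by
  obtain ⟨L, hL⟩ := exists_left_limit x y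
  have hxp : 0 < ‖x‖ := norm_pos_iff.2 hx
  have hr : rhoM x y = ‖x‖ * L := by
    refine Tendsto.limUnder_eq ?_
    refine (hL.const_mul ‖x‖).congr fun t => ?_
    rw [mul_div_assoc]
  rw [hr, mul_eq_zero, or_iff_right hxp.ne']
  obtain ⟨f, hf, hfL⟩ := exists_supp_le hx hL
  constructor
  · rintro rfl
    refine ⟨⟨f, hf, le_antisymm hfL (left_limit_le hL hf)⟩, fun k hk t ht => ?_⟩
    have h := left_limit_le hL hk
    have : 0 < t * ‖x‖ := mul_pos ht.1 hxp
    have : 0 ≤ (1 - t) * k y := mul_nonneg (by linarith [ht.2]) h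
    rw [map_add, map_smul, map_smul, hk.2, smul_eq_mul, smul_eq_mul]
    linarith
  · rintro ⟨⟨k, hk, hky⟩, H⟩
    refine le_antisymm (hky ▸ left_limit_le hL hk) (le_trans ?_ hfL)
    by_contra hneg
    push Not at hneg
    have hd : 0 < ‖x‖ - f y := by linarith
    refine H f hf (-f y / (‖x‖ - f y)) ⟨div_pos (by linarith) hd, ?_⟩ ?_
    · rw [div_lt_one hd]; linarith
    · rw [map_add, map_smul, map_smul, hf.2, smul_eq_mul, smul_eq_mul]
      field_simp
      ring
end

section
/- Let X be a reflexive real Banach space and Y a real Banach space such that K(X,Y) is an M-ideal in L(X,Y). Let T ∈ L(X,Y) be such that dist(T, K(X,Y)) < ‖T‖ and M_T = {x₀, −x₀} for some unit vector x₀ ∈ X, and suppose Tx₀ is a ρ₊-smooth point of Y. Then T is ρ₊-smooth (and hence also ρ₋-smooth) in L(X,Y). -/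
open Filter Set

lemma aux_ultra_limit {ι E : Type*} [NormedAddCommGroup E] [NormedSpace ℝ E]
    (U : Ultrafilter ι) (F : ι → (E →L[ℝ] ℝ)) (hF : ∀ i, ‖F i‖ ≤ 1) :
    ∃ f : E →L[ℝ] ℝ, ‖f‖ ≤ 1 ∧ ∀ e, Tendsto (fun i => F i e) U (nhds (f e)) := by
  have hc := WeakDual.isCompact_closedBall (𝕜 := ℝ) (E := E) 0 1
  have := isCompact_iff_ultrafilter_le_nhds.1 hc
    (U.map (fun i => StrongDual.toWeakDual (F i))) (by
      rw [le_principal_iff]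
      refine mem_map.2 (Filter.univ_mem' fun i => ?_)
      show (F i) ∈ Metric.closedBall (0 : StrongDual ℝ E) 1
      simpa using hF i)
  obtain ⟨f, hf, hle⟩ := this
  refine ⟨WeakDual.toStrongDual f, by simpa using hf, fun e => ?_⟩
  have h1 : Tendsto (fun i => StrongDual.toWeakDual (F i)) U (nhds f) := hle
  exact ((WeakDual.eval_continuous e).tendsto f).comp h1

lemma aux_rhoP_tendsto {E : Type*} [NormedAddCommGroup E] [NormedSpace ℝ E] (x y : E) :
    Tendsto (fun t : ℝ => ‖x‖ * (‖x + t • y‖ - ‖x‖) / t) (nhdsWithin (0 : ℝ) (Set.Ioi 0))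
      (nhds (rhoP x y)) := by
  apply tendsto_nhds_limUnder
  have hconv : ConvexOn ℝ univ (fun t : ℝ => ‖x + t • y‖) := by
    refine ⟨convex_univ, fun s _ t _ a b ha hb hab => ?_⟩
    have : x + (a • s + b • t) • y = a • (x + s • y) + b • (x + t • y) := by
      have hx : x = (a + b) • x := by rw [hab, one_smul]
      nth_rewrite 1 [hx]
      simp only [smul_eq_mul]
      module
    show ‖x + (a • s + b • t) • y‖ ≤ _
    rw [this]
    refine (norm_add_le _ _).trans ?_
    rw [norm_smul, norm_smul, Real.norm_of_nonneg ha, Real.norm_of_nonneg hb]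
    simp only [smul_eq_mul, le_refl]
  have h := hconv.hasDerivWithinAt_rightDeriv_of_mem_interior (x := 0) (by simp)
  rw [hasDerivWithinAt_iff_tendsto_slope' (by simp)] at h
  refine ⟨_, (h.const_mul ‖x‖).congr fun t => ?_⟩
  simp [slope_def_field]
  ring

lemma aux_rhoP_ge {E : Type*} [NormedAddCommGroup E] [NormedSpace ℝ E] (x y : E)
    (g : E →L[ℝ] ℝ) (hg : ‖g‖ ≤ 1) (hgx : g x = ‖x‖) : ‖x‖ * g y ≤ rhoP x y := by
  refine ge_of_tendsto (aux_rhoP_tendsto x y) ?_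
  filter_upwards [self_mem_nhdsWithin] with t ht
  have ht : 0 < t := ht
  rw [le_div_iff₀ ht, mul_assoc]
  refine mul_le_mul_of_nonneg_left ?_ (norm_nonneg _)
  have h1 : g (x + t • y) ≤ ‖x + t • y‖ :=
    (le_abs_self _).trans ((g.le_of_opNorm_le hg _).trans (by simp))
  simp only [map_add, map_smul, smul_eq_mul, hgx] at h1
  linarith

lemma aux_smooth_unique {E : Type*} [NormedAddCommGroup E] [NormedSpace ℝ E] (x : E)
    (hsm : ∀ y₁ y₂ : E, rhoP x (y₁ + y₂) = rhoP x y₁ + rhoP x y₂)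
    (g : E →L[ℝ] ℝ) (hg : ‖g‖ ≤ 1) (hgx : g x = ‖x‖) (y : E) : ‖x‖ * g y = rhoP x y := by
  have h1 := aux_rhoP_ge x y g hg hgx
  have h2 := aux_rhoP_ge x (-y) g hg hgx
  have h3 := hsm y (-y)
  have h4 := hsm 0 0
  simp only [add_neg_cancel, add_zero, map_neg] at *
  linarith

/-- If `K(X,Y)` is an M-ideal, a norm-one functional supporting `T` which agrees on the compacts
with a functional `g` in the unit ball is equal to `g`. -/
lemma aux_M_ideal {X Y : Type*} [NormedAddCommGroup X] [NormedSpace ℝ X]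
    [NormedAddCommGroup Y] [NormedSpace ℝ Y]
    (P : ((X →L[ℝ] Y) →L[ℝ] ℝ) →L[ℝ] ((X →L[ℝ] Y) →L[ℝ] ℝ))
    (hproj : ∀ f, P (P f) = P f)
    (hrange : ∀ f : (X →L[ℝ] Y) →L[ℝ] ℝ,
      (∃ g, P g = f) ↔ ∀ K : X →L[ℝ] Y, IsCompactOperator ⇑K → f K = 0)
    (hMnorm : ∀ f, ‖f‖ = ‖P f‖ + ‖f - P f‖)
    (T : X →L[ℝ] Y)
    (hdist : Metric.infDist T {S : X →L[ℝ] Y | IsCompactOperator ⇑S} < ‖T‖)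
    (f g : (X →L[ℝ] Y) →L[ℝ] ℝ) (hf : ‖f‖ ≤ 1) (hg : ‖g‖ ≤ 1) (hfT : f T = ‖T‖)
    (hfg : ∀ K : X →L[ℝ] Y, IsCompactOperator ⇑K → f K = g K) : f = g := by
  have hT : 0 < ‖T‖ := lt_of_le_of_lt Metric.infDist_nonneg hdist
  obtain ⟨K, hK, hTK⟩ := (Metric.infDist_lt_iff ⟨0, isCompactOperator_zero⟩).1 hdist
  rw [dist_eq_norm] at hTK
  have hPK : P f K = 0 := (hrange (P f)).1 ⟨f, rfl⟩ K hK
  have e1 : f T = P f (T - K) + (f - P f) T := by simp [hPK]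
  have e2 : P f (T - K) ≤ ‖P f‖ * ‖T - K‖ := (le_abs_self _).trans ((P f).le_opNorm _)
  have e3 : (f - P f) T ≤ ‖f - P f‖ * ‖T‖ := (le_abs_self _).trans ((f - P f).le_opNorm _)
  have e4 := hMnorm f
  have hPf : ‖P f‖ = 0 := by
    by_contra hne
    have hpos : 0 < ‖P f‖ := lt_of_le_of_ne (P f).opNorm_nonneg (Ne.symm hne)
    have := mul_lt_mul_of_pos_left hTK hpos
    nlinarith
  have hf1 : 1 ≤ ‖f‖ := by
    have : f T ≤ ‖f‖ * ‖T‖ := (le_abs_self _).trans (f.le_opNorm _)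
    rw [hfT] at this
    nlinarith
  replace hPf : P f = 0 := (ContinuousLinearMap.opNorm_zero_iff (P f)).1 hPf
  obtain ⟨h, hh⟩ := (hrange (f - g)).2 (fun K hK => by simp [hfg K hK])
  have h1 : P (f - g) = f - g := by rw [← hh, hproj]
  rw [map_sub, hPf, zero_sub] at h1
  have h2 : f = g - P g := by
    rw [sub_eq_add_neg, h1]; abel
  have h3 := hMnorm g
  rw [← h2] at h3
  have h4 : ‖P g‖ = 0 := le_antisymm (by linarith) (P g).opNorm_nonneg
  replace h4 : P g = 0 := (ContinuousLinearMap.opNorm_zero_iff (P g)).1 h4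
  rw [h2, h4, sub_zero]

/-- The functional `A ↦ g (A x)` on `L(X,Y)`. -/
noncomputable def auxTensor {X Y : Type*} [NormedAddCommGroup X] [NormedSpace ℝ X]
    [NormedAddCommGroup Y] [NormedSpace ℝ Y] (g : Y →L[ℝ] ℝ) (x : X) :
    (X →L[ℝ] Y) →L[ℝ] ℝ :=
  g.comp (ContinuousLinearMap.apply ℝ Y x)

lemma auxTensor_apply {X Y : Type*} [NormedAddCommGroup X] [NormedSpace ℝ X]
    [NormedAddCommGroup Y] [NormedSpace ℝ Y] (g : Y →L[ℝ] ℝ) (x : X) (A : X →L[ℝ] Y) :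
    auxTensor g x A = g (A x) := rfl

lemma aux_bound {X Y : Type*} [NormedAddCommGroup X] [NormedSpace ℝ X]
    [NormedAddCommGroup Y] [NormedSpace ℝ Y] (g : Y →L[ℝ] ℝ) (x : X) (A : X →L[ℝ] Y)
    (hg : ‖g‖ ≤ 1) (hx : ‖x‖ ≤ 1) : |g (A x)| ≤ ‖A‖ := by
  have h1 : |g (A x)| ≤ 1 * ‖A x‖ := g.le_of_opNorm_le hg _
  have h2 := A.le_opNorm x
  have h3 := mul_le_mul_of_nonneg_left hx (norm_nonneg A)
  linarith

lemma auxTensor_norm {X Y : Type*} [NormedAddCommGroup X] [NormedSpace ℝ X]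
    [NormedAddCommGroup Y] [NormedSpace ℝ Y] (g : Y →L[ℝ] ℝ) (x : X)
    (hg : ‖g‖ ≤ 1) (hx : ‖x‖ ≤ 1) : ‖auxTensor g x‖ ≤ 1 := by
  refine ContinuousLinearMap.opNorm_le_bound _ zero_le_one fun A => ?_
  rw [auxTensor_apply, one_mul]
  exact aux_bound g x A hg hx

/-- Near-norming pair for an operator. -/
lemma aux_norming {X Y : Type*} [NormedAddCommGroup X] [NormedSpace ℝ X]
    [NormedAddCommGroup Y] [NormedSpace ℝ Y] (A : X →L[ℝ] Y) (ε : ℝ) (hε : 0 < ε) :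
    ∃ p : X × (Y →L[ℝ] ℝ), ‖p.1‖ ≤ 1 ∧ ‖p.2‖ ≤ 1 ∧ ‖A‖ - ε < p.2 (A p.1) := by
  have : ∃ x : X, ‖x‖ ≤ 1 ∧ ‖A‖ - ε < ‖A x‖ := by
    by_contra! h
    by_cases h0 : 0 ≤ ‖A‖ - ε
    · have := A.opNorm_le_of_unit_norm h0 (fun x hx => h x hx.le)
      linarith
    · have := h 0 (by simp)
      simp at this
      linarith
  obtain ⟨x, hx, hAx⟩ := this
  obtain ⟨g, hg, hgx⟩ := exists_dual_vector'' ℝ (A x)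
  exact ⟨(x, g), hx, hg, by simpa [hgx] using hAx⟩

lemma aux_compact {ι X Y : Type*} [NormedAddCommGroup X] [NormedSpace ℝ X]
    [NormedAddCommGroup Y] [NormedSpace ℝ Y] (U : Ultrafilter ι)
    (x : ι → X) (hx : ∀ i, ‖x i‖ ≤ 1) (g : ι → (Y →L[ℝ] ℝ)) (hg : ∀ i, ‖g i‖ ≤ 1)
    (x' : X) (g' : Y →L[ℝ] ℝ)
    (hxl : ∀ h : X →L[ℝ] ℝ, Tendsto (fun i => h (x i)) U (nhds (h x')))
    (hgl : ∀ y : Y, Tendsto (fun i => g i y) U (nhds (g' y)))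
    (K : X →L[ℝ] Y) (hK : IsCompactOperator ⇑K) :
    Tendsto (fun i => g i (K (x i))) U (nhds (g' (K x'))) := by
  have hK' : IsCompactOperator (K : X →ₗ[ℝ] Y) := hK
  obtain ⟨C, hC, hsub⟩ := hK'.image_closedBall_subset_compact 1
  obtain ⟨z, -, hz⟩ := isCompact_iff_ultrafilter_le_nhds.1 hC (U.map (fun i => K (x i))) (by
    rw [le_principal_iff]
    refine mem_map.2 (Filter.univ_mem' fun i => hsub ⟨x i, by simpa using hx i, rfl⟩))
  have hz : Tendsto (fun i => K (x i)) U (nhds z) := hz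
  have hzK : z = K x' := by
    rw [SeparatingDual.eq_iff_forall_dual_eq (R := ℝ)]
    intro h
    exact tendsto_nhds_unique ((h.continuous.tendsto z).comp hz) (hxl (h.comp K))
  rw [hzK] at hz
  have h1 : Tendsto (fun i => g i (K (x i) - K x')) U (nhds 0) := by
    refine squeeze_zero_norm (a := fun i => ‖K (x i) - K x'‖) (fun i => ?_) ?_
    · simpa using (g i).le_of_opNorm_le (hg i) (K (x i) - K x')
    · simpa using (hz.sub_const (K x')).norm
  have := h1.add (hgl (K x'))
  simpa using this

lemma aux_key
    {X Y : Type*} [NormedAddCommGroup X] [NormedSpace ℝ X]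
    [NormedAddCommGroup Y] [NormedSpace ℝ Y]
    (hrefl : Function.Surjective (NormedSpace.inclusionInDoubleDual ℝ X))
    (P : ((X →L[ℝ] Y) →L[ℝ] ℝ) →L[ℝ] ((X →L[ℝ] Y) →L[ℝ] ℝ))
    (hproj : ∀ f, P (P f) = P f)
    (hrange : ∀ f : (X →L[ℝ] Y) →L[ℝ] ℝ,
      (∃ g, P g = f) ↔ ∀ K : X →L[ℝ] Y, IsCompactOperator ⇑K → f K = 0)
    (hMnorm : ∀ f, ‖f‖ = ‖P f‖ + ‖f - P f‖)
    (T : X →L[ℝ] Y)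
    (hdist : Metric.infDist T {S : X →L[ℝ] Y | IsCompactOperator ⇑S} < ‖T‖)
    (x₀ : X) (hx₀ : ‖x₀‖ = 1)
    (hMT : {x : X | ‖x‖ = 1 ∧ ‖T x‖ = ‖T‖} = {x₀, -x₀})
    (hsm : ∀ y₁ y₂ : Y, rhoP (T x₀) (y₁ + y₂) = rhoP (T x₀) y₁ + rhoP (T x₀) y₂)
    (g₀ : Y →L[ℝ] ℝ) (hg₀ : ‖g₀‖ ≤ 1) (hgT : g₀ (T x₀) = ‖T x₀‖) (A : X →L[ℝ] Y) :
    Tendsto (fun t : ℝ => (‖T + t • A‖ - ‖T‖) / t) (nhdsWithin (0 : ℝ) (Set.Ioi 0))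
      (nhds (g₀ (A x₀))) := by
  have hT : 0 < ‖T‖ := lt_of_le_of_lt Metric.infDist_nonneg hdist
  have hTx₀ : ‖T x₀‖ = ‖T‖ := by
    have : x₀ ∈ {x : X | ‖x‖ = 1 ∧ ‖T x‖ = ‖T‖} := by rw [hMT]; simp
    exact this.2
  rw [tendsto_iff_ultrafilter]
  intro U hU
  have hUpos : ∀ᶠ t : ℝ in U, 0 < t := hU self_mem_nhdsWithin
  have hU0 : Tendsto (fun t : ℝ => t) U (nhds 0) := hU.trans nhdsWithin_le_nhds
  have hch : ∀ t : ℝ, ∃ p : X × (Y →L[ℝ] ℝ), ‖p.1‖ ≤ 1 ∧ ‖p.2‖ ≤ 1 ∧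
      (0 < t → ‖T + t • A‖ - t ^ 2 < p.2 ((T + t • A) p.1)) := by
    intro t
    by_cases ht : 0 < t
    · obtain ⟨p, h1, h2, h3⟩ := aux_norming (T + t • A) (t ^ 2) (by positivity)
      exact ⟨p, h1, h2, fun _ => h3⟩
    · exact ⟨0, by simp, by simp, fun h => absurd h ht⟩
  choose p hp1 hp2 hp3 using hch
  -- limits
  obtain ⟨f, hf, hfl⟩ := aux_ultra_limit U (fun t => auxTensor (p t).2 (p t).1)
    (fun t => auxTensor_norm _ _ (hp2 t) (hp1 t))
  obtain ⟨g', hg', hgl⟩ := aux_ultra_limit U (fun t => (p t).2) hp2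
  have hJ : ∀ x : X, ‖NormedSpace.inclusionInDoubleDual ℝ X x‖ = ‖x‖ :=
    (NormedSpace.inclusionInDoubleDualLi ℝ (E := X)).norm_map
  obtain ⟨x'', hx'', hxl⟩ := aux_ultra_limit U
    (fun t => NormedSpace.inclusionInDoubleDual ℝ X (p t).1) (fun t => by rw [hJ]; exact hp1 t)
  obtain ⟨x', rfl⟩ := hrefl x''
  rw [hJ] at hx''
  simp only [auxTensor_apply, NormedSpace.dual_def] at hfl hxl
  -- `f` supports `T`
  have hfT : f T = ‖T‖ := by
    refine tendsto_nhds_unique (hfl T) ?_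
    have hcont : Tendsto (fun t : ℝ => ‖T + t • A‖ - t ^ 2 - t * ‖A‖) U (nhds ‖T‖) := by
      have h : Continuous (fun t : ℝ => ‖T + t • A‖ - t ^ 2 - t * ‖A‖) := by fun_prop
      have := (h.tendsto 0).comp hU0
      simpa [Function.comp_def] using this
    refine tendsto_of_tendsto_of_tendsto_of_le_of_le' hcont tendsto_const_nhds ?_ ?_
    · filter_upwards [hUpos] with t ht
      have h1 := hp3 t ht
      have h2 := (abs_le.1 (aux_bound (p t).2 (p t).1 A (hp2 t) (hp1 t))).2
      have h3 := mul_le_mul_of_nonneg_left h2 ht.le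
      simp at h1
      linarith
    · exact Eventually.of_forall fun t =>
        (abs_le.1 (aux_bound (p t).2 (p t).1 T (hp2 t) (hp1 t))).2
  have hfg : f = auxTensor g' x' := by
    refine aux_M_ideal P hproj hrange hMnorm T hdist f _ hf (auxTensor_norm _ _ hg' hx'') hfT ?_
    intro K hK
    exact tendsto_nhds_unique (hfl K)
      (aux_compact U (fun t => (p t).1) hp1 (fun t => (p t).2) hp2 x' g' hxl hgl K hK)
  have hgx : g' (T x') = ‖T‖ := by rw [← hfT, hfg, auxTensor_apply]
  have hmem : x' ∈ ({x₀, -x₀} : Set X) := by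
    rw [← hMT]
    have h1 : |g' (T x')| ≤ 1 * ‖T x'‖ := g'.le_of_opNorm_le hg' _
    rw [hgx, abs_of_pos hT] at h1
    have h2 := T.le_opNorm x'
    constructor
    · refine le_antisymm hx'' ?_
      by_contra! hlt
      have := mul_lt_mul_of_pos_left hlt hT
      linarith
    · have := mul_le_mul_of_nonneg_left hx'' hT.le
      linarith
  have huniq : ∀ g : Y →L[ℝ] ℝ, ‖g‖ ≤ 1 → g (T x₀) = ‖T x₀‖ → g (A x₀) = g₀ (A x₀) := by
    intro g h1 h2
    have h3 := aux_smooth_unique (T x₀) hsm g h1 h2 (A x₀)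
    have h4 := aux_smooth_unique (T x₀) hsm g₀ hg₀ hgT (A x₀)
    rw [← h4, hTx₀] at h3
    exact mul_left_cancel₀ hT.ne' h3
  have hfA : f A = g₀ (A x₀) := by
    rw [hfg, auxTensor_apply]
    rcases hmem with h | h
    · rw [h] at hgx ⊢
      exact huniq g' hg' (by rw [hgx, hTx₀])
    · rw [mem_singleton_iff] at h
      rw [h] at hgx ⊢
      have := huniq (-g') (by simpa using hg') (by rw [hTx₀, ← hgx]; simp)
      rw [← this]; simp
  have hup : Tendsto (fun t : ℝ => (p t).2 (A (p t).1) + t) U (nhds (g₀ (A x₀))) := by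
    have := (hfl A).add hU0
    rwa [add_zero, hfA] at this
  refine tendsto_of_tendsto_of_tendsto_of_le_of_le' tendsto_const_nhds hup ?_ ?_
  · filter_upwards [hUpos] with t ht
    rw [le_div_iff₀ ht]
    have := (abs_le.1 (aux_bound g₀ x₀ (T + t • A) hg₀ hx₀.le)).2
    simp [hgT, hTx₀] at this
    linarith
  · filter_upwards [hUpos] with t ht
    rw [div_le_iff₀ ht]
    have h1 := hp3 t ht
    have h2 := (abs_le.1 (aux_bound (p t).2 (p t).1 T (hp2 t) (hp1 t))).2
    simp at h1
    linarith

/-- Sufficient condition for ρ₊-smoothness (hence ρ₋-smoothness) of an operator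
T ∈ L(X,Y), where X is reflexive, K(X,Y) is an M-ideal in L(X,Y),
dist(T, K(X,Y)) < ‖T‖, M_T = {x₀, -x₀}, and T x₀ is ρ₊-smooth in Y. -/
theorem rhoP_smooth_of_M_ideal
    {X Y : Type*} [NormedAddCommGroup X] [NormedSpace ℝ X] [CompleteSpace X]
    [NormedAddCommGroup Y] [NormedSpace ℝ Y] [CompleteSpace Y]
    -- X is reflexive:
    (hrefl : Function.Surjective (NormedSpace.inclusionInDoubleDual ℝ X))
    -- K(X,Y) is an M-ideal in L(X,Y): a projection P on the dual of L(X,Y)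
    (P : ((X →L[ℝ] Y) →L[ℝ] ℝ) →L[ℝ] ((X →L[ℝ] Y) →L[ℝ] ℝ))
    (hproj : ∀ f, P (P f) = P f)
    -- whose range is the annihilator of K(X,Y)
    (hrange : ∀ f : (X →L[ℝ] Y) →L[ℝ] ℝ,
      (∃ g, P g = f) ↔ ∀ K : X →L[ℝ] Y, IsCompactOperator ⇑K → f K = 0)
    -- such that ‖f‖ = ‖Pf‖ + ‖f - Pf‖ for every f in the dual
    (hMnorm : ∀ f, ‖f‖ = ‖P f‖ + ‖f - P f‖)
    (T : X →L[ℝ] Y)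
    (hdist : Metric.infDist T {S : X →L[ℝ] Y | IsCompactOperator ⇑S} < ‖T‖)
    (x₀ : X) (hx₀ : ‖x₀‖ = 1)
    (hMT : {x : X | ‖x‖ = 1 ∧ ‖T x‖ = ‖T‖} = {x₀, -x₀})
    (hsm : ∀ y₁ y₂ : Y, rhoP (T x₀) (y₁ + y₂) = rhoP (T x₀) y₁ + rhoP (T x₀) y₂) :
    (∀ A B : X →L[ℝ] Y, rhoP T (A + B) = rhoP T A + rhoP T B) ∧
      (∀ A B : X →L[ℝ] Y, rhoM T (A + B) = rhoM T A + rhoM T B) := by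
  obtain ⟨g₀, hg₀, hgT⟩ := exists_dual_vector'' ℝ (T x₀)
  have key := aux_key hrefl P hproj hrange hMnorm T hdist x₀ hx₀ hMT hsm g₀ hg₀ hgT
  have hP : ∀ A : X →L[ℝ] Y, rhoP T A = ‖T‖ * g₀ (A x₀) := by
    intro A
    refine Tendsto.limUnder_eq (((key A).const_mul ‖T‖).congr fun t => ?_)
    rw [mul_div_assoc]
  have hM : ∀ A : X →L[ℝ] Y, rhoM T A = ‖T‖ * g₀ (A x₀) := by
    intro A
    have hneg : Tendsto (fun t : ℝ => -t) (nhdsWithin (0 : ℝ) (Set.Iio 0))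
        (nhdsWithin (0 : ℝ) (Set.Ioi 0)) := by
      simpa using tendsto_neg_nhdsLT (a := (0 : ℝ))
    have h := ((key (-A)).comp hneg).const_mul (-‖T‖)
    refine Tendsto.limUnder_eq ?_
    have e : -‖T‖ * g₀ ((-A) x₀) = ‖T‖ * g₀ (A x₀) := by simp
    rw [e] at h
    refine h.congr fun t => ?_
    simp only [Function.comp_apply, smul_neg, neg_smul, neg_neg, div_neg]
    ring
  constructor
  · intro A B
    rw [hP, hP, hP]; simp [mul_add]
  · intro A B
    rw [hM, hM, hM]; simp [mul_add]
end

section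
/- Let X be a reflexive real Banach space and Y a real Banach space such that K(X,Y) is an M-ideal in L(X,Y). Let T ∈ L(X,Y) be such that dist(T, K(X,Y)) < ‖T‖ and M_T = {x₀, −x₀} for some unit vector x₀ ∈ X, and suppose Tx₀ is a ρ-smooth point of Y. Then T is ρ-smooth in L(X,Y). -/
open Filter Set

open Topology

lemma aux_limit {E ι : Type*} [NormedAddCommGroup E] [NormedSpace ℝ E] (U : Ultrafilter ι)
    (g : ι → (E →L[ℝ] ℝ)) (hg : ∀ i, ‖g i‖ ≤ 1) :
    ∃ h : E →L[ℝ] ℝ, ‖h‖ ≤ 1 ∧ ∀ v, Tendsto (fun i => g i v) U (𝓝 (h v)) := by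
  have hb : ∀ i v, ‖g i v‖ ≤ ‖v‖ := fun i v => by
    simpa using (g i).le_of_opNorm_le (hg i) v
  have key : ∀ v, ∃ a ∈ Metric.closedBall (0 : ℝ) ‖v‖, Tendsto (fun i => g i v) U (𝓝 a) := by
    intro v
    have := (isCompact_closedBall (0 : ℝ) ‖v‖).ultrafilter_le_nhds (U.map (fun i => g i v))
      (by
        rw [le_principal_iff]
        exact Filter.mem_map.2 (Filter.univ_mem' fun i => by simpa using hb i v))
    obtain ⟨a, ha, h⟩ := this
    exact ⟨a, ha, h⟩
  choose a ha hta using key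
  let L : E →ₗ[ℝ] ℝ :=
    { toFun := a
      map_add' := fun v w => tendsto_nhds_unique (hta (v + w)) (by
        simpa using (hta v).add (hta w))
      map_smul' := fun c v => tendsto_nhds_unique (hta (c • v)) (by
        simpa using (hta v).const_mul c) }
  refine ⟨L.mkContinuous 1 (fun v => by simpa [L] using ha v),
    LinearMap.mkContinuous_norm_le _ zero_le_one _, fun v => hta v⟩

lemma aux_deriv {E : Type*} [NormedAddCommGroup E] [NormedSpace ℝ E] (x y : E) :
    ∃ D : ℝ, Tendsto (fun t : ℝ => (‖x + t • y‖ - ‖x‖) / t) (𝓝[>] 0) (𝓝 D) ∧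
      ∀ t : ℝ, 0 < t → D ≤ (‖x + t • y‖ - ‖x‖) / t := by
  have mono : MonotoneOn (fun t : ℝ => (‖x + t • y‖ - ‖x‖) / t) (Ioi 0) := by
    intro s hs t ht hst
    have hs' : 0 < s := hs
    have ht' : 0 < t := ht
    show (‖x + s • y‖ - ‖x‖) / s ≤ (‖x + t • y‖ - ‖x‖) / t
    rw [div_le_div_iff₀ hs' ht']
    have e : t • (x + s • y) = s • (x + t • y) + (t - s) • x := by module
    have h1 : ‖t • (x + s • y)‖ ≤ s * ‖x + t • y‖ + (t - s) * ‖x‖ := by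
      rw [e]
      refine (norm_add_le _ _).trans ?_
      rw [norm_smul, norm_smul, Real.norm_of_nonneg hs'.le, Real.norm_of_nonneg (sub_nonneg.2 hst)]
    rw [norm_smul, Real.norm_of_nonneg ht'.le] at h1
    linarith
  have bdd : BddBelow ((fun t : ℝ => (‖x + t • y‖ - ‖x‖) / t) '' Ioi 0) := by
    refine ⟨-‖y‖, ?_⟩
    rintro _ ⟨t, ht, rfl⟩
    have ht' : 0 < t := ht
    show -‖y‖ ≤ (‖x + t • y‖ - ‖x‖) / t
    rw [le_div_iff₀ ht']
    have := norm_sub_le (x + t • y) (t • y)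
    rw [add_sub_cancel_right, norm_smul, Real.norm_of_nonneg ht'.le] at this
    linarith
  exact ⟨_, mono.tendsto_nhdsGT bdd, fun t ht => csInf_le bdd ⟨t, ht, rfl⟩⟩

lemma rhoP_eq {E : Type*} [NormedAddCommGroup E] [NormedSpace ℝ E] {x y : E} {D : ℝ}
    (h : Tendsto (fun t : ℝ => (‖x + t • y‖ - ‖x‖) / t) (𝓝[>] 0) (𝓝 D)) :
    rhoP x y = ‖x‖ * D := by
  unfold rhoP
  refine Tendsto.limUnder_eq ?_
  simpa [mul_div_assoc] using h.const_mul ‖x‖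

lemma rhoM_eq {E : Type*} [NormedAddCommGroup E] [NormedSpace ℝ E] (x y : E) :
    rhoM x y = - rhoP x (-y) := by
  obtain ⟨D, hD, -⟩ := aux_deriv x (-y)
  rw [rhoP_eq hD]
  unfold rhoM
  refine Tendsto.limUnder_eq ?_
  have hneg : Tendsto (fun t : ℝ => -t) (𝓝[<] 0) (𝓝[>] 0) := by
    simpa using tendsto_neg_nhdsLT (a := (0 : ℝ))
  have h := ((hD.comp hneg).const_mul ‖x‖).neg
  refine h.congr fun t => ?_
  simp only [Function.comp, neg_smul_neg]
  rw [div_neg, mul_neg, neg_neg, mul_div_assoc]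

lemma rhoP_operator
    {X Y : Type*} [NormedAddCommGroup X] [NormedSpace ℝ X]
    [NormedAddCommGroup Y] [NormedSpace ℝ Y]
    (hrefl : Function.Surjective (NormedSpace.inclusionInDoubleDual ℝ X))
    (P : ((X →L[ℝ] Y) →L[ℝ] ℝ) →L[ℝ] ((X →L[ℝ] Y) →L[ℝ] ℝ))
    (hproj : ∀ f, P (P f) = P f)
    (hrange : ∀ f : (X →L[ℝ] Y) →L[ℝ] ℝ,
      (∃ g, P g = f) ↔ ∀ K : X →L[ℝ] Y, IsCompactOperator ⇑K → f K = 0)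
    (hMnorm : ∀ f, ‖f‖ = ‖P f‖ + ‖f - P f‖)
    (T : X →L[ℝ] Y)
    (hdist : Metric.infDist T {S : X →L[ℝ] Y | IsCompactOperator ⇑S} < ‖T‖)
    (x₀ : X) (hx₀ : ‖x₀‖ = 1)
    (hMT : {x : X | ‖x‖ = 1 ∧ ‖T x‖ = ‖T‖} = {x₀, -x₀}) (A : X →L[ℝ] Y) :
    rhoP T A = rhoP (T x₀) (A x₀) := by
  have hT : 0 < ‖T‖ := Metric.infDist_nonneg.trans_lt hdist
  obtain ⟨K₀, hK₀, hTK⟩ := (Metric.infDist_lt_iff ⟨0, isCompactOperator_zero⟩).1 hdist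
  rw [dist_eq_norm] at hTK
  have hTx₀ : ‖T x₀‖ = ‖T‖ := by
    have : x₀ ∈ {x : X | ‖x‖ = 1 ∧ ‖T x‖ = ‖T‖} := by rw [hMT]; simp
    exact this.2
  obtain ⟨D, hD, hDle⟩ := aux_deriv T A
  -- almost norming pairs
  have hex : ∀ t : ℝ, ∃ (x : X) (φ : Y →L[ℝ] ℝ), ‖x‖ ≤ 1 ∧ ‖φ‖ ≤ 1 ∧
      (0 < t → ‖T + t • A‖ - t ^ 2 ≤ φ ((T + t • A) x)) := by
    intro t
    by_cases ht : 0 < t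
    · obtain ⟨x, hx, hx'⟩ := ContinuousLinearMap.exists_lt_apply_of_lt_opNorm (T + t • A)
        (show ‖T + t • A‖ - t ^ 2 < ‖T + t • A‖ by have := pow_pos ht 2; linarith)
      obtain ⟨φ, hφ, hφ'⟩ := exists_dual_vector'' ℝ ((T + t • A) x)
      refine ⟨x, φ, hx.le, hφ, fun _ => ?_⟩
      rw [hφ']
      exact hx'.le
    · exact ⟨0, 0, by simp, by simp, fun h => absurd h ht⟩
  choose x φ hx hφ hxφ using hex
  let U : Ultrafilter ℝ := Ultrafilter.of (𝓝[>] 0)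
  have hU : (U : Filter ℝ) ≤ 𝓝[>] 0 := Ultrafilter.of_le _
  -- elementary tensors
  let ten : X → (Y →L[ℝ] ℝ) → ((X →L[ℝ] Y) →L[ℝ] ℝ) := fun x φ =>
    φ.comp (ContinuousLinearMap.apply ℝ Y x)
  have ten_apply : ∀ x φ S, ten x φ S = φ (S x) := fun _ _ _ => rfl
  have ten_norm : ∀ x φ, ‖x‖ ≤ 1 → ‖φ‖ ≤ 1 → ‖ten x φ‖ ≤ 1 := by
    intro x φ hx hφ
    refine ContinuousLinearMap.opNorm_le_bound _ zero_le_one fun S => ?_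
    rw [ten_apply, one_mul]
    have h1 := φ.le_of_opNorm_le hφ (S x)
    have h2 := S.le_opNorm_of_le hx
    linarith
  obtain ⟨h, hh, hlim⟩ := aux_limit U (fun t => ten (x t) (φ t))
    (fun t => ten_norm _ _ (hx t) (hφ t))
  obtain ⟨ψ, hψ, hψlim⟩ := aux_limit U φ hφ
  obtain ⟨ξ, hξ, hξlim⟩ := aux_limit U
    (fun t => NormedSpace.inclusionInDoubleDual ℝ X (x t))
    (fun t => (NormedSpace.double_dual_bound ℝ X (x t)).trans (hx t))
  obtain ⟨z, rfl⟩ := hrefl ξ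
  have hz : ‖z‖ ≤ 1 := by
    have : ‖NormedSpace.inclusionInDoubleDualLi ℝ (E := X) z‖ = ‖z‖ := LinearIsometry.norm_map _ _
    rw [← this]
    exact hξ
  have hzlim : ∀ f : X →L[ℝ] ℝ, Tendsto (fun t => f (x t)) U (𝓝 (f z)) := hξlim
  have hφb : ∀ t v, |φ t v| ≤ ‖v‖ := fun t v => by
    simpa using (φ t).le_of_opNorm_le (hφ t) v
  -- on compact operators the limit is the elementary tensor
  have hcomp : ∀ K : X →L[ℝ] Y, IsCompactOperator ⇑K → h K = ten z ψ K := by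
    intro K hK
    have hKx : Tendsto (fun t => K (x t)) U (𝓝 (K z)) := by
      obtain ⟨w, -, hw⟩ := (hK.isCompact_closure_image_closedBall 1).ultrafilter_le_nhds
        (U.map (fun t => K (x t))) (by
          rw [le_principal_iff]
          exact Filter.mem_map.2 (Filter.univ_mem' fun t => subset_closure
            ⟨x t, by simpa using hx t, rfl⟩))
      have hw' : Tendsto (fun t => K (x t)) U (𝓝 w) := hw
      have : w = K z := by
        refine (SeparatingDual.eq_iff_forall_dual_eq (R := ℝ)).2 fun f => ?_
        exact tendsto_nhds_unique ((f.continuous.tendsto w).comp hw') (hzlim (f.comp K))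
      rwa [this] at hw'
    refine tendsto_nhds_unique (hlim K) ?_
    have h0 : Tendsto (fun t => φ t (K (x t) - K z)) U (𝓝 0) := by
      refine squeeze_zero_norm (fun t => hφb t _) ?_
      exact (tendsto_iff_norm_sub_tendsto_zero.1 hKx)
    have := h0.add (hψlim (K z))
    simpa [ten_apply] using this
  -- the values at T and A
  have tend : Tendsto (fun t : ℝ => t) U (𝓝 0) :=
    (tendsto_id.mono_left nhdsWithin_le_nhds).mono_left hU
  have hpos : ∀ᶠ t : ℝ in (U : Filter ℝ), 0 < t := hU self_mem_nhdsWithin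
  have habs : ∀ (t : ℝ) (S : X →L[ℝ] Y), |φ t (S (x t))| ≤ ‖S‖ := fun t S => by
    have h2 := S.le_opNorm_of_le (hx t)
    exact (hφb t _).trans (by simpa using h2)
  have hexp : ∀ t : ℝ, φ t ((T + t • A) (x t)) = φ t (T (x t)) + t * φ t (A (x t)) := by
    intro t; simp
  have hhT : ‖T‖ ≤ h T := by
    have h1 : Tendsto (fun t : ℝ => ‖T‖ - 2 * t * ‖A‖ - t ^ 2) U
        (𝓝 (‖T‖ - 2 * 0 * ‖A‖ - 0 ^ 2)) :=
      (tendsto_const_nhds.sub ((tend.const_mul 2).mul_const _)).sub (tend.pow 2)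
    have h2 := le_of_tendsto_of_tendsto h1 (hlim T) (by
      filter_upwards [hpos] with t ht
      have a1 := hxφ t ht
      rw [hexp] at a1
      have a2 := (abs_le.1 (habs t A)).2
      have a3 := norm_sub_le (T + t • A) (t • A)
      rw [add_sub_cancel_right, norm_smul, Real.norm_of_nonneg ht.le] at a3
      rw [ten_apply]
      nlinarith)
    simpa using h2
  have hhA : D ≤ h A := by
    have h1 : Tendsto (fun t : ℝ => D - t) U (𝓝 (D - 0)) := tendsto_const_nhds.sub tend
    have h2 := le_of_tendsto_of_tendsto h1 (hlim A) (by
      filter_upwards [hpos] with t ht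
      have a1 := hxφ t ht
      rw [hexp] at a1
      have a2 := (abs_le.1 (habs t T)).2
      have a3 := hDle t ht
      rw [le_div_iff₀ ht] at a3
      rw [ten_apply]
      refine le_of_mul_le_mul_left ?_ ht
      nlinarith)
    simpa using h2
  -- P h = 0
  have hPh : P h = 0 := by
    by_contra hne
    have hp : 0 < ‖P h‖ := (norm_pos_iff (a := P h)).2 hne
    have a0 : P h K₀ = 0 := (hrange (P h)).1 ⟨h, rfl⟩ K₀ hK₀
    have a1 : P h T ≤ ‖P h‖ * ‖T - K₀‖ := by
      have := (le_abs_self _).trans ((P h).le_opNorm (T - K₀))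
      rwa [map_sub, a0, sub_zero] at this
    have a2 : (h - P h) T ≤ ‖h - P h‖ * ‖T‖ := (le_abs_self _).trans ((h - P h).le_opNorm T)
    have a3 : h T = P h T + (h - P h) T := by simp
    have a4 := hMnorm h
    nlinarith
  have hnorm : 1 ≤ ‖h‖ := by
    have a2 : h T ≤ ‖h‖ * ‖T‖ := (le_abs_self _).trans (h.le_opNorm T)
    by_contra hlt
    nlinarith
  have hgh : ten z ψ = h := by
    have a1 : P (h - ten z ψ) = h - ten z ψ := by
      obtain ⟨w, hw⟩ := (hrange (h - ten z ψ)).2 fun K hK => by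
        rw [ContinuousLinearMap.sub_apply, hcomp K hK, sub_self]
      rw [← hw, hproj]
    rw [map_sub, hPh, zero_sub] at a1
    have a2 : ten z ψ - P (ten z ψ) = h := by
      rw [sub_eq_add_neg, a1]; abel
    have a3 := hMnorm (ten z ψ)
    rw [a2] at a3
    have a4 := ten_norm z ψ hz hψ
    have a5 : P (ten z ψ) = 0 :=
      (norm_le_zero_iff (a := P (ten z ψ))).1 (by linarith)
    rw [← a2, a5, sub_zero]
  rw [← hgh, ten_apply] at hhT hhA
  have hψb : ∀ v, ψ v ≤ ‖v‖ := fun v => (le_abs_self _).trans (by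
    simpa using ψ.le_of_opNorm_le hψ v)
  have hTz : ‖T‖ ≤ ‖T z‖ := hhT.trans (hψb _)
  have hz1 : ‖z‖ = 1 := by
    refine le_antisymm hz ?_
    have := T.le_opNorm z
    by_contra hlt
    nlinarith
  have hTz' : ‖T z‖ = ‖T‖ := le_antisymm (by simpa [hz1] using T.le_opNorm z) hTz
  have hzmem : z = x₀ ∨ z = -x₀ := by
    have : z ∈ {x : X | ‖x‖ = 1 ∧ ‖T x‖ = ‖T‖} := ⟨hz1, hTz'⟩
    rw [hMT] at this
    simpa using this
  have hlow : ∀ t : ℝ, 0 < t → ‖T‖ + t * D ≤ ‖T x₀ + t • A x₀‖ := by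
    intro t ht
    have a1 := hψb (T z + t • A z)
    rw [map_add, map_smul, smul_eq_mul] at a1
    have a2 : ‖T z + t • A z‖ = ‖T x₀ + t • A x₀‖ := by
      rcases hzmem with rfl | rfl
      · rfl
      · rw [map_neg, map_neg, smul_neg, ← neg_add, norm_neg]
    rw [a2] at a1
    nlinarith
  have hD' : Tendsto (fun t : ℝ => (‖T x₀ + t • A x₀‖ - ‖T x₀‖) / t) (𝓝[>] 0) (𝓝 D) := by
    refine tendsto_of_tendsto_of_tendsto_of_le_of_le' tendsto_const_nhds hD ?_ ?_
    · filter_upwards [self_mem_nhdsWithin] with t ht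
      have ht' : 0 < t := ht
      rw [le_div_iff₀ ht', hTx₀]
      have := hlow t ht
      linarith
    · filter_upwards [self_mem_nhdsWithin] with t ht
      have ht' : 0 < t := ht
      rw [hTx₀]
      have := (T + t • A).le_opNorm x₀
      rw [hx₀, mul_one] at this
      have e : (T + t • A) x₀ = T x₀ + t • A x₀ := rfl
      rw [e] at this
      gcongr
  rw [rhoP_eq hD, rhoP_eq hD', hTx₀]

/-- Sufficient condition for ρ-smoothness of an operator T ∈ L(X,Y), where X is
reflexive, K(X,Y) is an M-ideal in L(X,Y), dist(T, K(X,Y)) < ‖T‖,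
M_T = {x₀, -x₀}, and T x₀ is ρ-smooth in Y. -/
theorem rho_smooth_of_M_ideal
    {X Y : Type*} [NormedAddCommGroup X] [NormedSpace ℝ X] [CompleteSpace X]
    [NormedAddCommGroup Y] [NormedSpace ℝ Y] [CompleteSpace Y]
    -- X is reflexive:
    (hrefl : Function.Surjective (NormedSpace.inclusionInDoubleDual ℝ X))
    -- K(X,Y) is an M-ideal in L(X,Y): a projection P on the dual of L(X,Y)
    (P : ((X →L[ℝ] Y) →L[ℝ] ℝ) →L[ℝ] ((X →L[ℝ] Y) →L[ℝ] ℝ))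
    (hproj : ∀ f, P (P f) = P f)
    -- whose range is the annihilator of K(X,Y)
    (hrange : ∀ f : (X →L[ℝ] Y) →L[ℝ] ℝ,
      (∃ g, P g = f) ↔ ∀ K : X →L[ℝ] Y, IsCompactOperator ⇑K → f K = 0)
    -- such that ‖f‖ = ‖Pf‖ + ‖f - Pf‖ for every f in the dual
    (hMnorm : ∀ f, ‖f‖ = ‖P f‖ + ‖f - P f‖)
    (T : X →L[ℝ] Y)
    (hdist : Metric.infDist T {S : X →L[ℝ] Y | IsCompactOperator ⇑S} < ‖T‖)
    (x₀ : X) (hx₀ : ‖x₀‖ = 1)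
    (hMT : {x : X | ‖x‖ = 1 ∧ ‖T x‖ = ‖T‖} = {x₀, -x₀})
    (hsm : ∀ y₁ y₂ : Y, rho (T x₀) (y₁ + y₂) = rho (T x₀) y₁ + rho (T x₀) y₂) :
    ∀ A B : X →L[ℝ] Y, rho T (A + B) = rho T A + rho T B := by
  have key := rhoP_operator hrefl P hproj hrange hMnorm T hdist x₀ hx₀ hMT
  have key2 : ∀ A : X →L[ℝ] Y, rho T A = rho (T x₀) (A x₀) := by
    intro A
    unfold rho
    rw [rhoM_eq, rhoM_eq, key, key]
    rfl
  intro A B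
  rw [key2, key2, key2]
  exact hsm _ _
end
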